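/- Let 1/3 < β < α < 1, let x : [0,2] → ℝ be α-Hölder, let σ : ℝ → ℝ be of class C² with σ, σ′, σ″ bounded, let b : ℝ → ℝ be Lipschitz and bounded, and let y_0 ∈ ℝ. Then there exist a β-Hölder function y : [0,2] → ℝ with y(0) = y_0 and a β-Lévy area A of order 0 associated with γ = (x, y) such that for every t ∈ [0,1] the limit as ε ↓ 0 of ε^{−1} ∫_0^t ((σ(y(s)) + σ(y(s+ε)))/2)(x(s+ε) − x(s)) ds + ε^{−1} ∫_0^t σ′(y(s)) A_{s,s+ε} ds exists and equals y(t) − y_0 − ∫_0^t b(y(s)) ds; that is, y(t) = y_0 + ∫_0^t b(y(s)) ds + ∫_0^t σ(y(s)) d^{A,1}x(s) for all t ∈ [0,1]. -/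

import Mathlib

open MeasureTheory Filter Set

/-- `z` is `α`-Hölder on the interval `[a, b]`. -/
def HolderOnIcc (α a b : ℝ) (z : ℝ → ℝ) : Prop :=
  ∃ L > 0, ∀ s ∈ Set.Icc a b, ∀ t ∈ Set.Icc a b, |z t - z s| ≤ L * |t - s| ^ α

/-- `A` is a `β`-Lévy area of order 0 associated with `γ = (x, y)` on `[0, 2]`. -/
def IsLevyArea0 (β : ℝ) (x y : ℝ → ℝ) (A : ℝ → ℝ → ℝ) : Prop :=
  (∀ r ∈ Set.Icc (0:ℝ) 2, ∀ s ∈ Set.Icc (0:ℝ) 2, ∀ t ∈ Set.Icc (0:ℝ) 2,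
    A r s + A s t + A t r
      = -(1/2) * ((y t - y s) * (x r - x s) - (y r - y s) * (x t - x s)))
  ∧ ∃ C > 0, ∀ s ∈ Set.Icc (0:ℝ) 2, ∀ t ∈ Set.Icc (0:ℝ) 2,
      |A s t| ≤ C * |t - s| ^ (2 * β)

/-- The `ε`-approximation `I_ε^{[a,b]}(f)` of the corrected symmetric integral. -/
noncomputable def Ieps (x y : ℝ → ℝ) (A : ℝ → ℝ → ℝ) (f : ℝ → ℝ) (a b ε : ℝ) : ℝ :=
  ε⁻¹ * (∫ u in a..b, ((f (y u) + f (y (u + ε))) / 2) * (x (u + ε) - x u))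
    + ε⁻¹ * (∫ u in a..b, deriv f (y u) * A u (u + ε))


theorem aux_mvt {g g' : ℝ → ℝ} {C a b : ℝ} (hg : ∀ r, HasDerivAt g (g' r) r)
    (hb : ∀ r ∈ Set.uIcc a b, |g' r| ≤ C) : |g b - g a| ≤ C * |b - a| := by
  have := (convex_uIcc a b).norm_image_sub_le_of_norm_hasDerivWithin_le (f := g) (f' := g') (C := C)
    (fun r _ => (hg r).hasDerivWithinAt) (fun r hr => hb r hr) Set.left_mem_uIcc Set.right_mem_uIcc
  simpa [Real.norm_eq_abs] using this

theorem aux_abs_sub_le {a b r : ℝ} (hr : r ∈ Set.uIcc a b) : |r - a| ≤ |b - a| :=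
  Set.abs_sub_left_of_mem_uIcc hr

theorem aux_taylor1 {g p : ℝ → ℝ} {C : ℝ} (hg : ∀ r, HasDerivAt g (p r) r)
    (hp : ∀ r s, |p r - p s| ≤ C * |r - s|) (a b : ℝ) (hC : 0 ≤ C) :
    |g b - g a - p a * (b - a)| ≤ C * |b - a| ^ 2 := by
  have h := aux_mvt (g := fun r => g r - p a * (r - a)) (g' := fun r => p r - p a)
    (C := C * |b - a|) (a := a) (b := b) (fun r => by
      have := (hg r).sub (((hasDerivAt_id r).sub_const a).const_mul (p a))
      exact this.congr_deriv (by simp)) (fun r hr => (hp r a).trans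
        (mul_le_mul_of_nonneg_left (aux_abs_sub_le hr) hC))
  have e : g b - g a - p a * (b - a) = (g b - p a * (b - a)) - (g a - p a * (a - a)) := by ring
  rw [e]; refine h.trans (le_of_eq (by ring))

theorem aux_taylor2 {g p q : ℝ → ℝ} {C : ℝ} (hg : ∀ r, HasDerivAt g (p r) r)
    (hp : ∀ r, HasDerivAt p (q r) r)
    (hq : ∀ r s, |q r - q s| ≤ C * |r - s|) (a b : ℝ) (hC : 0 ≤ C) :
    |g b - g a - p a * (b - a) - 1 / 2 * q a * (b - a) ^ 2| ≤ C * |b - a| ^ 3 := by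
  have h := aux_mvt (g := fun r => g r - p a * (r - a) - 1 / 2 * q a * (r - a) ^ 2)
    (g' := fun r => p r - p a - q a * (r - a))
    (C := C * |b - a| ^ 2) (a := a) (b := b) (fun r => by
      have := ((hg r).sub (((hasDerivAt_id r).sub_const a).const_mul (p a))).sub
        ((((hasDerivAt_id r).sub_const a).pow 2).const_mul (1 / 2 * q a))
      refine this.congr_deriv ?_
      simp; ring) (fun r hr => (aux_taylor1 hp hq a r hC).trans
        (mul_le_mul_of_nonneg_left
          (pow_le_pow_left₀ (abs_nonneg _) (aux_abs_sub_le hr) 2) hC))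
  have e : g b - g a - p a * (b - a) - 1 / 2 * q a * (b - a) ^ 2
    = (g b - p a * (b - a) - 1 / 2 * q a * (b - a) ^ 2)
      - (g a - p a * (a - a) - 1 / 2 * q a * (a - a) ^ 2) := by ring
  rw [e]; refine h.trans (le_of_eq (by ring))

/-- Global solutions of bounded Lipschitz ODEs. -/
theorem aux_globalODE (f : ℝ → ℝ → ℝ) (K : NNReal) (N : ℝ) (hlip : ∀ t, LipschitzWith K (f t))
    (hcont : ∀ z, Continuous (fun t => f t z)) (hN : ∀ t z, |f t z| ≤ N) (z0 : ℝ) :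
    ∃ z : ℝ → ℝ, z 0 = z0 ∧ ∀ t, HasDerivAt z (f t (z t)) t := by
  have hN0 : 0 ≤ N := (abs_nonneg _).trans (hN 0 0)
  have key : ∀ n : ℕ, ∃ z : ℝ → ℝ, z 0 = z0 ∧
      ∀ t ∈ Set.Ioo (-((n:ℝ)+1)) ((n:ℝ)+1), HasDerivAt z (f t (z t)) t := by
    intro n
    have hn : (0:ℝ) ≤ (n:ℝ) + 1 := by positivity
    have h0 : (0:ℝ) ∈ Set.Icc (-((n:ℝ)+1)) ((n:ℝ)+1) := ⟨by linarith, hn⟩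
    have hP : IsPicardLindelof f (tmin := -((n:ℝ)+1)) (tmax := (n:ℝ)+1) ⟨0, h0⟩ z0
        ⟨N * ((n:ℝ)+1), by positivity⟩ 0 ⟨N, hN0⟩ K :=
      { lipschitzOnWith := fun t _ => (hlip t).lipschitzOnWith
        continuousOn := fun z _ => (hcont z).continuousOn
        norm_le := fun t _ z _ => hN t z
        mul_max_le := by simp; exact le_rfl }
    obtain ⟨z, hz, hd⟩ := hP.exists_eq_forall_mem_Icc_hasDerivWithinAt₀
    exact ⟨z, hz, fun t ht => (hd t (Set.Ioo_subset_Icc_self ht)).hasDerivAt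
      (Icc_mem_nhds ht.1 ht.2)⟩
  choose Z hZ0 hZd using key
  have huniq : ∀ n m : ℕ, n ≤ m → Set.EqOn (Z n) (Z m) (Set.Ioo (-((n:ℝ)+1)) ((n:ℝ)+1)) := by
    intro n m hnm
    have hnm' : (n:ℝ) ≤ m := by exact_mod_cast hnm
    have hn : (0:ℝ) < (n:ℝ) + 1 := by positivity
    refine ODE_solution_unique_of_mem_Ioo (v := f) (s := fun _ => Set.univ) (K := K) (t₀ := 0)
      (fun t _ => (hlip t).lipschitzOnWith) ⟨by linarith, hn⟩
      (fun t ht => ⟨hZd n t ht, trivial⟩)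
      (fun t ht => ⟨hZd m t ⟨by linarith [ht.1], by linarith [ht.2]⟩, trivial⟩) ?_
    rw [hZ0, hZ0]
  have hmem : ∀ t : ℝ, t ∈ Set.Ioo (-((⌈|t|⌉₊:ℝ)+1)) ((⌈|t|⌉₊:ℝ)+1) := by
    intro t
    have := abs_le.1 (Nat.le_ceil |t|)
    exact ⟨by linarith [this.1], by linarith [this.2]⟩
  have heq : ∀ (n : ℕ) (t : ℝ), t ∈ Set.Ioo (-((n:ℝ)+1)) ((n:ℝ)+1) → Z ⌈|t|⌉₊ t = Z n t := by
    intro n t ht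
    rcases le_total n ⌈|t|⌉₊ with h | h
    · exact (huniq _ _ h ht).symm
    · exact huniq _ _ h (hmem t)
  refine ⟨fun t => Z ⌈|t|⌉₊ t, hZ0 _, fun t => ?_⟩
  refine (hZd _ t (hmem t)).congr_of_eventuallyEq ?_
  filter_upwards [Ioo_mem_nhds (hmem t).1 (hmem t).2] with s hs
  exact heq _ s hs

theorem aux_exp {a b c : ℝ} (ha : a ≤ c) (hb : b ≤ c) :
    |Real.exp b - Real.exp a| ≤ Real.exp c * |b - a| := by
  refine aux_mvt (fun r => Real.hasDerivAt_exp r) (fun r hr => ?_)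
  rw [abs_of_pos (Real.exp_pos _)]
  exact Real.exp_le_exp.2 (hr.2.trans (max_le ha hb))

/-- The explicit form of the difference of two trajectories. -/
theorem aux_flow_diff {σ σ' : ℝ → ℝ} {M : ℝ} (hσ : ∀ r, HasDerivAt σ (σ' r) r)
    (hσ'c : Continuous σ') (hM : ∀ r, |σ' r| ≤ M) (hlip : ∀ r s, |σ' r - σ' s| ≤ M * |r - s|)
    {u v : ℝ → ℝ} (hu : ∀ h, HasDerivAt u (σ (u h)) h) (hv : ∀ h, HasDerivAt v (σ (v h)) h) :
    ∃ q : ℝ → ℝ, Continuous q ∧ (∀ h, |q h| ≤ M) ∧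
      (∀ h, |q h - σ' (u h)| ≤ M * |v h - u h|) ∧
      ∀ h, v h - u h = (v 0 - u 0) * Real.exp (∫ r in (0:ℝ)..h, q r) := by
  have hM0 : 0 ≤ M := (abs_nonneg _).trans (hM 0)
  have huc : Continuous u := continuous_iff_continuousAt.2 fun h => (hu h).continuousAt
  have hvc : Continuous v := continuous_iff_continuousAt.2 fun h => (hv h).continuousAt
  let q : ℝ → ℝ := fun h => ∫ θ in (0:ℝ)..1, σ' (u h + θ * (v h - u h))
  have hqc : Continuous q := by
    refine intervalIntegral.continuous_parametric_intervalIntegral_of_continuous'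
      (f := fun h θ => σ' (u h + θ * (v h - u h))) ?_ 0 1
    fun_prop
  have hqD : ∀ h, q h * (v h - u h) = σ (v h) - σ (u h) := by
    intro h
    have h1 : ∀ θ ∈ Set.uIcc (0:ℝ) 1, HasDerivAt (fun θ => σ (u h + θ * (v h - u h)))
        (σ' (u h + θ * (v h - u h)) * (v h - u h)) θ := by
      intro θ _
      have : HasDerivAt (fun θ => u h + θ * (v h - u h)) (v h - u h) θ := by
        simpa using ((hasDerivAt_id θ).mul_const (v h - u h)).const_add (u h)
      exact (hσ _).comp θ this
    have h2 := intervalIntegral.integral_eq_sub_of_hasDerivAt h1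
      (Continuous.intervalIntegrable (by fun_prop) _ _)
    rw [intervalIntegral.integral_mul_const] at h2
    simpa using h2
  refine ⟨q, hqc, fun h => ?_, fun h => ?_, fun h => ?_⟩
  · have := intervalIntegral.norm_integral_le_of_norm_le_const (a := 0) (b := 1) (C := M)
      (f := fun θ => σ' (u h + θ * (v h - u h))) (fun θ _ => hM _)
    simpa using this
  · have e : q h - σ' (u h) = ∫ θ in (0:ℝ)..1, (σ' (u h + θ * (v h - u h)) - σ' (u h)) := by
      rw [intervalIntegral.integral_sub (Continuous.intervalIntegrable (by fun_prop) _ _)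
        (Continuous.intervalIntegrable (by fun_prop) _ _)]
      simp [q]
    rw [e]
    have := intervalIntegral.norm_integral_le_of_norm_le_const (a := 0) (b := 1)
      (C := M * |v h - u h|)
      (f := fun θ => σ' (u h + θ * (v h - u h)) - σ' (u h)) (fun θ hθ => by
        rw [Set.uIoc_of_le zero_le_one] at hθ
        refine (hlip _ _).trans (mul_le_mul_of_nonneg_left ?_ hM0)
        rw [add_sub_cancel_left, abs_mul, abs_of_pos hθ.1]
        exact mul_le_of_le_one_left (abs_nonneg _) hθ.2)
    simpa using this
  · have hd : ∀ r, HasDerivAt (fun h => (v h - u h) * Real.exp (-∫ r in (0:ℝ)..h, q r)) 0 r := by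
      intro r
      have h1 := (hv r).sub (hu r)
      have h2 : HasDerivAt (fun h => ∫ r in (0:ℝ)..h, q r) (q r) r :=
        intervalIntegral.integral_hasDerivAt_right (hqc.intervalIntegrable _ _)
          (hqc.stronglyMeasurableAtFilter _ _) hqc.continuousAt
      refine (h1.mul h2.neg.exp).congr_deriv ?_
      have := hqD r
      simp only [Pi.sub_apply, Pi.neg_apply]
      rw [← this]; ring
    have hc := is_const_of_deriv_eq_zero (fun r => (hd r).differentiableAt)
      (fun r => (hd r).deriv) h 0
    simp at hc
    rw [← hc, mul_assoc, ← Real.exp_add]; simp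

/-- `P` is the derivative of `G` in the second variable, with uniform quadratic remainder, and
`P` is jointly Lipschitz, for first variable in `[-R, R]`. -/
def AuxGood (R : ℝ) (G P : ℝ → ℝ → ℝ) : Prop :=
  ∃ C : ℝ, 0 ≤ C ∧ ∀ h h' z z' : ℝ, |h| ≤ R → |h'| ≤ R →
    |G h z' - G h z - P h z * (z' - z)| ≤ C * |z' - z| ^ 2 ∧
    |P h z' - P h' z| ≤ C * (|z' - z| + |h - h'|)

theorem aux_int_bound {f : ℝ → ℝ} {R C h : ℝ} (hC : 0 ≤ C) (hh : |h| ≤ R)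
    (hf : ∀ r, |r| ≤ R → |f r| ≤ C) : |∫ r in (0:ℝ)..h, f r| ≤ R * C := by
  have := intervalIntegral.norm_integral_le_of_norm_le_const (a := 0) (b := h) (C := C)
    (f := f) (fun r hr => by
      refine hf r (le_trans ?_ hh)
      have := aux_abs_sub_le (Set.uIoc_subset_uIcc hr)
      simpa using this)
  rw [sub_zero] at this
  refine this.trans ?_
  rw [mul_comm]
  exact mul_le_mul_of_nonneg_right hh hC

theorem aux_int_hasDeriv {q : ℝ → ℝ} (hqc : Continuous q) (r : ℝ) :
    HasDerivAt (fun h => ∫ r in (0:ℝ)..h, q r) (q r) r :=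
  intervalIntegral.integral_hasDerivAt_right (hqc.intervalIntegrable _ _)
    (hqc.stronglyMeasurableAtFilter _ _) hqc.continuousAt

section flow

variable {σ σ' : ℝ → ℝ} {M R : ℝ} {φ : ℝ → ℝ → ℝ}

theorem aux_phi_cont (hφ : ∀ z h, HasDerivAt (fun h => φ h z) (σ (φ h z)) h) (z : ℝ) :
    Continuous (fun h => φ h z) :=
  continuous_iff_continuousAt.2 fun h => (hφ z h).continuousAt

theorem aux_phi_lip (hσ : ∀ r, HasDerivAt σ (σ' r) r)
    (hσ'c : Continuous σ') (hM : ∀ r, |σ' r| ≤ M) (hlip : ∀ r s, |σ' r - σ' s| ≤ M * |r - s|)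
    (hφ0 : ∀ z, φ 0 z = z) (hφ : ∀ z h, HasDerivAt (fun h => φ h z) (σ (φ h z)) h)
    {h z z' : ℝ} (hh : |h| ≤ R) :
    |φ h z' - φ h z| ≤ Real.exp (R * M) * |z' - z| := by
  obtain ⟨q, hqc, hqM, -, hq⟩ := aux_flow_diff hσ hσ'c hM hlip (hφ z) (hφ z')
  have hM0 : 0 ≤ M := (abs_nonneg _).trans (hM 0)
  rw [hq h, hφ0, hφ0, abs_mul, abs_of_pos (Real.exp_pos _), mul_comm]
  refine mul_le_mul_of_nonneg_right (Real.exp_le_exp.2 ?_) (abs_nonneg _)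
  exact (le_abs_self _).trans (aux_int_bound hM0 hh (fun r _ => hqM r))

/-- The derivative of the flow in the initial condition. -/
noncomputable def auxJ (σ' : ℝ → ℝ) (φ : ℝ → ℝ → ℝ) (h z : ℝ) : ℝ :=
  Real.exp (∫ r in (0:ℝ)..h, σ' (φ r z))

theorem aux_J_upper (hM : ∀ r, |σ' r| ≤ M) {h z : ℝ} (hh : |h| ≤ R) :
    auxJ σ' φ h z ≤ Real.exp (R * M) := by
  have hM0 : 0 ≤ M := (abs_nonneg _).trans (hM 0)
  exact Real.exp_le_exp.2 ((le_abs_self _).trans (aux_int_bound hM0 hh (fun r _ => hM _)))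

theorem aux_J_inv_upper (hM : ∀ r, |σ' r| ≤ M) {h z : ℝ} (hh : |h| ≤ R) :
    (auxJ σ' φ h z)⁻¹ ≤ Real.exp (R * M) := by
  have hM0 : 0 ≤ M := (abs_nonneg _).trans (hM 0)
  unfold auxJ
  rw [← Real.exp_neg]
  exact Real.exp_le_exp.2 ((neg_le_abs _).trans (aux_int_bound hM0 hh (fun r _ => hM _)))

theorem aux_J_cont (hσ'c : Continuous σ')
    (hφ : ∀ z h, HasDerivAt (fun h => φ h z) (σ (φ h z)) h) (z : ℝ) :
    Continuous (fun h => auxJ σ' φ h z) := by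
  unfold auxJ
  have h1 : Continuous (fun r => σ' (φ r z)) := hσ'c.comp (aux_phi_cont hφ z)
  refine Real.continuous_exp.comp ?_
  exact continuous_iff_continuousAt.2 fun h => (aux_int_hasDeriv h1 h).continuousAt

theorem aux_good_phi (hσ : ∀ r, HasDerivAt σ (σ' r) r)
    (hσ'c : Continuous σ') (hM : ∀ r, |σ' r| ≤ M) (hlip : ∀ r s, |σ' r - σ' s| ≤ M * |r - s|)
    (hφ0 : ∀ z, φ 0 z = z) (hφ : ∀ z h, HasDerivAt (fun h => φ h z) (σ (φ h z)) h)
    (hR : 0 ≤ R) : AuxGood R φ (auxJ σ' φ) := by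
  have hM0 : 0 ≤ M := (abs_nonneg _).trans (hM 0)
  set E := Real.exp (R * M) with hE
  have hE0 : 0 < E := Real.exp_pos _
  have hc : ∀ z, Continuous (fun r => σ' (φ r z)) := fun z => hσ'c.comp (aux_phi_cont hφ z)
  refine ⟨E * (R * (M * E)) + E * M, by positivity, fun h h' z z' hh hh' => ⟨?_, ?_⟩⟩
  · obtain ⟨q, hqc, hqM, hqs, hq⟩ := aux_flow_diff hσ hσ'c hM hlip (hφ z) (hφ z')
    have e : φ h z' - φ h z - auxJ σ' φ h z * (z' - z)
        = (z' - z) * (Real.exp (∫ r in (0:ℝ)..h, q r) -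
            Real.exp (∫ r in (0:ℝ)..h, σ' (φ r z))) := by
      rw [hq h, hφ0, hφ0]; unfold auxJ; ring
    rw [e, abs_mul]
    have h1 : |(∫ r in (0:ℝ)..h, q r) - ∫ r in (0:ℝ)..h, σ' (φ r z)|
        ≤ R * (M * E * |z' - z|) := by
      rw [← intervalIntegral.integral_sub (hqc.intervalIntegrable _ _)
        ((hc z).intervalIntegrable _ _)]
      refine aux_int_bound (by positivity) hh (fun r hr => (hqs r).trans ?_)
      rw [mul_assoc]
      exact mul_le_mul_of_nonneg_left (aux_phi_lip hσ hσ'c hM hlip hφ0 hφ hr) hM0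
    have h2 := aux_exp (a := ∫ r in (0:ℝ)..h, σ' (φ r z)) (b := ∫ r in (0:ℝ)..h, q r)
      (c := R * M) ((le_abs_self _).trans (aux_int_bound hM0 hh (fun r _ => hM _)))
      ((le_abs_self _).trans (aux_int_bound hM0 hh (fun r _ => hqM _)))
    calc _ ≤ |z' - z| * (E * (R * (M * E * |z' - z|))) := by
            refine mul_le_mul_of_nonneg_left (h2.trans ?_) (abs_nonneg _)
            exact mul_le_mul_of_nonneg_left h1 hE0.le
      _ = (E * (R * (M * E))) * |z' - z| ^ 2 := by ring
      _ ≤ _ := by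
            refine mul_le_mul_of_nonneg_right ?_ (by positivity)
            have : 0 ≤ E * M := by positivity
            linarith
  · have h1 : |(∫ r in (0:ℝ)..h, σ' (φ r z')) - ∫ r in (0:ℝ)..h, σ' (φ r z)|
        ≤ R * (M * E * |z' - z|) := by
      rw [← intervalIntegral.integral_sub ((hc z').intervalIntegrable _ _)
        ((hc z).intervalIntegrable _ _)]
      refine aux_int_bound (by positivity) hh (fun r hr => (hlip _ _).trans ?_)
      rw [mul_assoc]
      exact mul_le_mul_of_nonneg_left (aux_phi_lip hσ hσ'c hM hlip hφ0 hφ hr) hM0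
    have h3 : |(∫ r in (0:ℝ)..h, σ' (φ r z)) - ∫ r in (0:ℝ)..h', σ' (φ r z)|
        ≤ M * |h - h'| :=
      aux_mvt (aux_int_hasDeriv (hc z)) (fun r _ => hM _)
    have h4 := abs_sub_le (∫ r in (0:ℝ)..h, σ' (φ r z')) (∫ r in (0:ℝ)..h, σ' (φ r z))
      (∫ r in (0:ℝ)..h', σ' (φ r z))
    have h2 := aux_exp (a := ∫ r in (0:ℝ)..h', σ' (φ r z)) (b := ∫ r in (0:ℝ)..h, σ' (φ r z'))
      (c := R * M) ((le_abs_self _).trans (aux_int_bound hM0 hh' (fun r _ => hM _)))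
      ((le_abs_self _).trans (aux_int_bound hM0 hh (fun r _ => hM _)))
    unfold auxJ
    refine h2.trans ?_
    calc _ ≤ E * (R * (M * E * |z' - z|) + M * |h - h'|) :=
            mul_le_mul_of_nonneg_left (by linarith) hE0.le
      _ ≤ _ := by
            have : 0 ≤ E * M * |z' - z| := by positivity
            have : 0 ≤ E * (R * (M * E)) * |h - h'| := by positivity
            nlinarith

theorem aux_good_int {G P : ℝ → ℝ → ℝ} {B : ℝ} (hR : 0 ≤ R) (hB : 0 ≤ B) (hG : AuxGood R G P)
    (hGc : ∀ z, Continuous (fun h => G h z)) (hPc : ∀ z, Continuous (fun h => P h z))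
    (hPB : ∀ h z, |h| ≤ R → |P h z| ≤ B) :
    AuxGood R (fun h z => ∫ r in (0:ℝ)..h, G r z) (fun h z => ∫ r in (0:ℝ)..h, P r z) := by
  obtain ⟨C, hC, hG⟩ := hG
  refine ⟨R * C + B, by positivity, fun h h' z z' hh hh' => ⟨?_, ?_⟩⟩
  · have e : (∫ r in (0:ℝ)..h, G r z') - (∫ r in (0:ℝ)..h, G r z)
        - (∫ r in (0:ℝ)..h, P r z) * (z' - z)
        = ∫ r in (0:ℝ)..h, (G r z' - G r z - P r z * (z' - z)) := by
      rw [intervalIntegral.integral_sub, intervalIntegral.integral_sub,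
        intervalIntegral.integral_mul_const]
      · exact (hGc z').intervalIntegrable _ _
      · exact (hGc z).intervalIntegrable _ _
      · exact ((hGc z').sub (hGc z)).intervalIntegrable _ _
      · exact ((hPc z).mul continuous_const).intervalIntegrable _ _
    simp only []
    rw [e]
    refine (aux_int_bound (C := C * |z' - z| ^ 2) (by positivity) hh
      (fun r hr => (hG r r z z' hr hr).1)).trans ?_
    have : 0 ≤ B * |z' - z| ^ 2 := by positivity
    linarith
  · have h1 : |(∫ r in (0:ℝ)..h, P r z') - ∫ r in (0:ℝ)..h, P r z| ≤ R * (C * |z' - z|) := by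
      rw [← intervalIntegral.integral_sub ((hPc z').intervalIntegrable _ _)
        ((hPc z).intervalIntegrable _ _)]
      refine aux_int_bound (by positivity) hh (fun r hr => ?_)
      simpa using (hG r r z z' hr hr).2
    have h3 : |(∫ r in (0:ℝ)..h, P r z) - ∫ r in (0:ℝ)..h', P r z| ≤ B * |h - h'| := by
      refine aux_mvt (aux_int_hasDeriv (hPc z)) (fun r hr => hPB _ _ ?_)
      rw [abs_le] at hh hh' ⊢
      exact ⟨(le_min hh'.1 hh.1).trans hr.1, hr.2.trans (max_le hh'.2 hh.2)⟩
    have h4 := abs_sub_le (∫ r in (0:ℝ)..h, P r z') (∫ r in (0:ℝ)..h, P r z)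
      (∫ r in (0:ℝ)..h', P r z)
    have : 0 ≤ B * |z' - z| := by positivity
    have : 0 ≤ R * C * |h - h'| := by positivity
    simp only []
    nlinarith

end flow

theorem aux_good_cont {G P : ℝ → ℝ → ℝ} {R : ℝ} (hG : AuxGood R G P) {X z : ℝ → ℝ}
    (hX : Continuous X) (hz : Continuous z) (hXR : ∀ t, |X t| ≤ R) :
    Continuous (fun t => P (X t) (z t)) := by
  obtain ⟨C, hC, hG⟩ := hG
  rw [continuous_iff_continuousAt]
  intro s
  rw [ContinuousAt, tendsto_iff_norm_sub_tendsto_zero]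
  refine squeeze_zero (fun _ => norm_nonneg _)
    (fun t => (hG (X t) (X s) (z s) (z t) (hXR t) (hXR s)).2) ?_
  have : Continuous (fun t => C * (|z t - z s| + |X t - X s|)) := by fun_prop
  simpa using this.tendsto s

/-- The drift part of the change of variables formula. -/
theorem aux_ito {G P : ℝ → ℝ → ℝ} {R N : ℝ} (hG : AuxGood R G P) {X z z' : ℝ → ℝ}
    (hX : Continuous X) (hz : ∀ t, HasDerivAt z (z' t) t) (hz'c : Continuous z')
    (hN : ∀ t, |z' t| ≤ N) (hXR : ∀ t, |X t| ≤ R) :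
    ∃ C : ℝ, 0 ≤ C ∧ ∀ s t D : ℝ, (∀ r ∈ Set.uIcc s t, |X t - X r| ≤ D) →
      |G (X t) (z t) - G (X t) (z s) - ∫ r in s..t, P (X r) (z r) * z' r|
        ≤ C * (|t - s| * (|t - s| + D)) := by
  have hN0 : 0 ≤ N := (abs_nonneg _).trans (hN 0)
  have hzc : Continuous z := continuous_iff_continuousAt.2 fun h => (hz h).continuousAt
  have hPc := aux_good_cont hG hX hzc hXR
  obtain ⟨C, hC, hG⟩ := hG
  refine ⟨C * N * N + C * N * N + C * N, by positivity, fun s t D hD => ?_⟩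
  have hD0 : 0 ≤ D := (abs_nonneg _).trans (hD s Set.left_mem_uIcc)
  have hzl : ∀ a b, |z b - z a| ≤ N * |b - a| := fun a b => aux_mvt hz (fun r _ => hN r)
  have h1 := (hG (X t) (X t) (z s) (z t) (hXR t) (hXR t)).1
  have hzi : ∫ r in s..t, z' r = z t - z s :=
    intervalIntegral.integral_eq_sub_of_hasDerivAt (fun r _ => hz r)
      (hz'c.intervalIntegrable _ _)
  have e : P (X t) (z s) * (z t - z s) - ∫ r in s..t, P (X r) (z r) * z' r
      = ∫ r in s..t, (P (X t) (z s) - P (X r) (z r)) * z' r := by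
    rw [← hzi, ← intervalIntegral.integral_const_mul, ← intervalIntegral.integral_sub]
    · congr 1; ext r; ring
    · exact (hz'c.const_mul _).intervalIntegrable _ _
    · exact (hPc.mul hz'c).intervalIntegrable _ _
  have h2 : |∫ r in s..t, (P (X t) (z s) - P (X r) (z r)) * z' r|
      ≤ (C * (N * |t - s| + D) * N) * |t - s| := by
    refine intervalIntegral.norm_integral_le_of_norm_le_const (E := ℝ)
      (f := fun r => (P (X t) (z s) - P (X r) (z r)) * z' r) (fun r hr => ?_)
    have hr' := Set.uIoc_subset_uIcc hr
    rw [Real.norm_eq_abs, abs_mul]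
    refine mul_le_mul ?_ (hN r) (abs_nonneg _) (by positivity)
    refine (hG (X t) (X r) (z r) (z s) (hXR t) (hXR r)).2.trans ?_
    refine mul_le_mul_of_nonneg_left (add_le_add ?_ (hD r hr')) hC
    rw [abs_sub_comm]
    exact (hzl s r).trans (mul_le_mul_of_nonneg_left (aux_abs_sub_le hr') hN0)
  rw [← e] at h2
  have h3 : |z t - z s| ^ 2 ≤ (N * |t - s|) ^ 2 :=
    pow_le_pow_left₀ (abs_nonneg _) (hzl s t) 2
  have h3' := mul_le_mul_of_nonneg_left h3 hC
  have h4 := abs_add_le (G (X t) (z t) - G (X t) (z s) - P (X t) (z s) * (z t - z s))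
    (P (X t) (z s) * (z t - z s) - ∫ r in s..t, P (X r) (z r) * z' r)
  rw [sub_add_sub_cancel] at h4
  refine h4.trans ((add_le_add (h1.trans h3') h2).trans ?_)
  have : 0 ≤ C * N * N * |t - s| * D := by positivity
  have : 0 ≤ C * N * |t - s| * |t - s| := by positivity
  nlinarith

theorem aux_core {β R L M N : ℝ} {K : NNReal} (hβ : 0 < β) (hβ1 : β < 1)
    {X : ℝ → ℝ} (hX : Continuous X) (hX0 : X 0 = 0) (hXR : ∀ t, |X t| ≤ R) (hL : 0 ≤ L)
    (hXL : ∀ s t, |X t - X s| ≤ L * |t - s| ^ β)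
    {σ σ' b : ℝ → ℝ} (hσ : ∀ r, HasDerivAt σ (σ' r) r)
    (hσ'c : Continuous σ') (hσM : ∀ r, |σ r| ≤ M) (hM : ∀ r, |σ' r| ≤ M)
    (hlip : ∀ r s, |σ' r - σ' s| ≤ M * |r - s|)
    (hb : LipschitzWith K b) (hbN : ∀ r, |b r| ≤ N) (y₀ : ℝ) :
    ∃ y F : ℝ → ℝ, ∃ C : ℝ, 0 < C ∧ Continuous y ∧ Continuous F ∧ y 0 = y₀ ∧
      ∀ s ∈ Set.Icc (0:ℝ) 2, ∀ t ∈ Set.Icc (0:ℝ) 2,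
        |y t - y s| ≤ C * |t - s| ^ β ∧
        |y t - y s - (∫ r in s..t, b (y r)) - σ (y s) * (X t - X s)
          - 1 / 2 * (σ' (y s) * σ (y s)) * (X t - X s) ^ 2|
          ≤ C * ((|t - s| ^ β) ^ 3 + |t - s| * |t - s| ^ β) ∧
        |F t - F s - y s * (X t - X s) - 1 / 2 * σ (y s) * (X t - X s) ^ 2|
          ≤ C * ((|t - s| ^ β) ^ 3 + |t - s| * |t - s| ^ β) := by
  have hM0 : 0 ≤ M := (abs_nonneg _).trans (hM 0)
  have hN0 : 0 ≤ N := (abs_nonneg _).trans (hbN 0)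
  have hR : 0 ≤ R := (abs_nonneg _).trans (hXR 0)
  have hσlip : ∀ r s, |σ r - σ s| ≤ M * |r - s| := fun r s => aux_mvt hσ (fun r _ => hM r)
  have hσc : Continuous σ := continuous_iff_continuousAt.2 fun h => (hσ h).continuousAt
  -- the flow of `σ`
  have hflow : ∀ z0 : ℝ, ∃ z : ℝ → ℝ, z 0 = z0 ∧ ∀ t, HasDerivAt z (σ (z t)) t := by
    intro z0
    refine aux_globalODE (fun _ => σ) ⟨M, hM0⟩ M (fun _ => ?_) (fun z => continuous_const)
      (fun _ z => hσM z) z0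
    refine LipschitzWith.of_dist_le_mul (fun r s => ?_)
    simp only [Real.dist_eq]
    exact hσlip r s
  choose ψ hψ0 hψd using hflow
  let φ : ℝ → ℝ → ℝ := fun h z => ψ z h
  have hφ0 : ∀ z, φ 0 z = z := hψ0
  have hφ : ∀ z h, HasDerivAt (fun h => φ h z) (σ (φ h z)) h := hψd
  clear_value φ
  have hφc := aux_phi_cont hφ
  set E := Real.exp (R * M) with hE
  have hE0 : 0 < E := Real.exp_pos _
  have hφz : ∀ {h z z' : ℝ}, |h| ≤ R → |φ h z' - φ h z| ≤ E * |z' - z| :=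
    fun hh => aux_phi_lip hσ hσ'c hM hlip hφ0 hφ hh
  have hφh : ∀ h h' z : ℝ, |φ h z - φ h' z| ≤ M * |h - h'| :=
    fun h h' z => aux_mvt (hφ z) (fun r _ => hσM _)
  let J := auxJ σ' φ
  have hJpos : ∀ h z, 0 < J h z := fun h z => Real.exp_pos _
  have hJu : ∀ h z, |h| ≤ R → J h z ≤ E := fun h z hh => aux_J_upper hM hh
  have hJi : ∀ h z, |h| ≤ R → (J h z)⁻¹ ≤ E := fun h z hh => aux_J_inv_upper hM hh
  have hJc : ∀ z, Continuous (fun h => J h z) := aux_J_cont hσ'c hφ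
  have hgood : AuxGood R φ J := aux_good_phi hσ hσ'c hM hlip hφ0 hφ hR
  have hgoodH : AuxGood R (fun h z => ∫ r in (0:ℝ)..h, φ r z) (fun h z => ∫ r in (0:ℝ)..h, J r z) :=
    aux_good_int hR hE0.le hgood hφc hJc (fun h z hh => by
      rw [abs_of_pos (hJpos h z)]; exact hJu h z hh)
  clear_value J
  -- the ODE for `z`
  have hz : ∃ z : ℝ → ℝ, z 0 = y₀ ∧ ∀ t, HasDerivAt z (b (φ (X t) (z t)) * (J (X t) (z t))⁻¹) t := by
    obtain ⟨C, hC, hg⟩ := hgood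
    refine aux_globalODE (fun t z => b (φ (X t) z) * (J (X t) z)⁻¹)
      ⟨K * E * E + N * (E * E * C), by positivity⟩ (N * E) (fun t => ?_) (fun z => ?_)
      (fun t z => ?_) y₀
    · refine LipschitzWith.of_dist_le_mul (fun z' z => ?_)
      simp only [Real.dist_eq]
      have h1 : |b (φ (X t) z') - b (φ (X t) z)| ≤ K * (E * |z' - z|) := by
        have := hb.dist_le_mul (φ (X t) z') (φ (X t) z)
        simp only [Real.dist_eq] at this
        exact this.trans (mul_le_mul_of_nonneg_left (hφz (hXR t)) K.2)
      have h2 : |(J (X t) z')⁻¹ - (J (X t) z)⁻¹| ≤ E * E * (C * |z' - z|) := by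
        have e : (J (X t) z')⁻¹ - (J (X t) z)⁻¹
            = (J (X t) z')⁻¹ * (J (X t) z)⁻¹ * -(J (X t) z' - J (X t) z) := by
          have := (hJpos (X t) z').ne'
          have := (hJpos (X t) z).ne'
          field_simp
          ring
        rw [e, abs_mul, abs_neg, abs_mul, abs_of_pos (inv_pos.2 (hJpos _ _)),
          abs_of_pos (inv_pos.2 (hJpos _ _))]
        have h3 := (hg (X t) (X t) z z' (hXR t) (hXR t)).2
        simp only [sub_self, abs_zero, add_zero] at h3
        exact mul_le_mul (mul_le_mul (hJi _ _ (hXR t)) (hJi _ _ (hXR t))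
          (inv_pos.2 (hJpos _ _)).le hE0.le) h3 (abs_nonneg _) (by positivity)
      have e : b (φ (X t) z') * (J (X t) z')⁻¹ - b (φ (X t) z) * (J (X t) z)⁻¹
          = (b (φ (X t) z') - b (φ (X t) z)) * (J (X t) z')⁻¹
            + b (φ (X t) z) * ((J (X t) z')⁻¹ - (J (X t) z)⁻¹) := by ring
      rw [e]
      refine (abs_add_le _ _).trans ?_
      rw [abs_mul, abs_mul, abs_of_pos (inv_pos.2 (hJpos _ _))]
      have h4 := mul_le_mul h1 (hJi _ z' (hXR t)) (inv_pos.2 (hJpos _ _)).le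
        (by have := K.2; positivity)
      have h5 := mul_le_mul (hbN (φ (X t) z)) h2 (abs_nonneg _) hN0
      refine (add_le_add h4 h5).trans (le_of_eq ?_)
      change _ = (K * E * E + N * (E * E * C)) * |z' - z|
      ring
    · refine Continuous.mul (hb.continuous.comp ((hφc z).comp hX)) ?_
      exact ((hJc z).comp hX).inv₀ (fun t => (hJpos _ _).ne')
    · rw [abs_mul, abs_of_pos (inv_pos.2 (hJpos _ _))]
      exact mul_le_mul (hbN _) (hJi _ _ (hXR t)) (inv_pos.2 (hJpos _ _)).le hN0
  obtain ⟨z, hz0, hzd⟩ := hz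
  have hzc : Continuous z := continuous_iff_continuousAt.2 fun h => (hzd h).continuousAt
  let y : ℝ → ℝ := fun t => φ (X t) (z t)
  have hyd : ∀ s t, |y t - y s| ≤ E * |z t - z s| + M * |X t - X s| := by
    intro s t
    refine (abs_sub_le _ (φ (X t) (z s)) _).trans ?_
    exact add_le_add (hφz (hXR t)) (hφh _ _ _)
  have hyc : Continuous y := by
    rw [continuous_iff_continuousAt]
    intro s
    rw [ContinuousAt, tendsto_iff_norm_sub_tendsto_zero]
    refine squeeze_zero (fun _ => norm_nonneg _) (fun t => hyd s t) ?_
    have : Continuous (fun t => E * |z t - z s| + M * |X t - X s|) := by fun_prop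
    simpa using this.tendsto s
  let z' : ℝ → ℝ := fun t => b (y t) * (J (X t) (z t))⁻¹
  have hJXc : Continuous (fun t => J (X t) (z t)) := aux_good_cont hgood hX hzc hXR
  have hz'c : Continuous z' :=
    (hb.continuous.comp hyc).mul (hJXc.inv₀ (fun t => (hJpos _ _).ne'))
  have hz'N : ∀ t, |z' t| ≤ N * E := by
    intro t
    simp only [z']
    rw [abs_mul, abs_of_pos (inv_pos.2 (hJpos _ _))]
    exact mul_le_mul (hbN _) (hJi _ _ (hXR t)) (inv_pos.2 (hJpos _ _)).le hN0
  have hzd' : ∀ t, HasDerivAt z (z' t) t := hzd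
  have hzl : ∀ s t, |z t - z s| ≤ N * E * |t - s| := fun s t => aux_mvt hzd' (fun r _ => hz'N r)
  have hJz : ∀ t, J (X t) (z t) * z' t = b (y t) := by
    intro t
    have := (hJpos (X t) (z t)).ne'
    simp only [z']
    field_simp
  obtain ⟨C1, hC1, hI1⟩ := aux_ito hgood hX hzd' hz'c hz'N hXR
  obtain ⟨C2, hC2, hI2⟩ := aux_ito hgoodH hX hzd' hz'c hz'N hXR
  let g2 : ℝ → ℝ := fun r => (∫ u in (0:ℝ)..X r, J u (z r)) * z' r
  have hg2c : Continuous g2 := (aux_good_cont hgoodH hX hzc hXR).mul hz'c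
  let F : ℝ → ℝ := fun t => (∫ u in (0:ℝ)..X t, φ u (z t)) - ∫ r in (0:ℝ)..t, g2 r
  have hHh : ∀ h h' w : ℝ, |h| ≤ R → |h'| ≤ R →
      |(∫ u in (0:ℝ)..h', φ u w) - (∫ u in (0:ℝ)..h, φ u w) - φ h w * (h' - h)
        - 1 / 2 * σ (φ h w) * (h' - h) ^ 2| ≤ M * M * |h' - h| ^ 3 := by
    intro h h' w _ _
    refine aux_taylor2 (aux_int_hasDeriv (hφc w)) (hφ w) (fun r s => ?_) h h' (by positivity)
    refine (hσlip _ _).trans ?_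
    rw [mul_assoc]
    exact mul_le_mul_of_nonneg_left (hφh _ _ _) hM0
  have hφT : ∀ h h' w : ℝ,
      |φ h' w - φ h w - σ (φ h w) * (h' - h)
        - 1 / 2 * (σ' (φ h w) * σ (φ h w)) * (h' - h) ^ 2| ≤ 2 * M * M * M * |h' - h| ^ 3 := by
    intro h h' w
    refine aux_taylor2 (hφ w) (fun r => (hσ _).comp r (hφ w r)) (fun r s => ?_) h h'
      (by positivity)
    have e : σ' (φ r w) * σ (φ r w) - σ' (φ s w) * σ (φ s w)
        = (σ' (φ r w) - σ' (φ s w)) * σ (φ r w) + σ' (φ s w) * (σ (φ r w) - σ (φ s w)) := by ring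
    rw [e]
    refine (abs_add_le _ _).trans ?_
    rw [abs_mul, abs_mul]
    have k0 := hφh r s w
    have k1 := (hlip (φ r w) (φ s w)).trans (mul_le_mul_of_nonneg_left k0 hM0)
    have k2 := (hσlip (φ r w) (φ s w)).trans (mul_le_mul_of_nonneg_left k0 hM0)
    have k3 := mul_le_mul k1 (hσM (φ r w)) (abs_nonneg _) (by positivity)
    have k4 := mul_le_mul (hM (φ s w)) k2 (abs_nonneg _) (by positivity)
    refine (add_le_add k3 k4).trans (le_of_eq (by ring))
  have hFc : Continuous F := by
    have h1 : Continuous (fun t => ∫ u in (0:ℝ)..X t, φ u (z t)) := by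
      obtain ⟨C, hC, hg⟩ := hgoodH
      rw [continuous_iff_continuousAt]
      intro s
      rw [ContinuousAt, tendsto_iff_norm_sub_tendsto_zero]
      have hBd : ∀ t, |(∫ u in (0:ℝ)..X t, φ u (z t)) - ∫ u in (0:ℝ)..X s, φ u (z s)|
          ≤ R * (E * |z t - z s|) + |(∫ u in (0:ℝ)..X t, φ u (z s)) - ∫ u in (0:ℝ)..X s, φ u (z s)| := by
        intro t
        refine (abs_sub_le _ (∫ u in (0:ℝ)..X t, φ u (z s)) _).trans (add_le_add ?_ le_rfl)
        rw [← intervalIntegral.integral_sub ((hφc _).intervalIntegrable _ _)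
          ((hφc _).intervalIntegrable _ _)]
        exact aux_int_bound (by positivity) (hXR t) (fun r hr => hφz hr)
      refine squeeze_zero (fun _ => norm_nonneg _) hBd ?_
      have h0 : Continuous (fun h => ∫ u in (0:ℝ)..h, φ u (z s)) :=
        continuous_iff_continuousAt.2 fun h => (aux_int_hasDeriv (hφc (z s)) h).continuousAt
      have h0' : Continuous (fun t => ∫ u in (0:ℝ)..X t, φ u (z s)) := h0.comp hX
      have : Continuous (fun t => R * (E * |z t - z s|)
          + |(∫ u in (0:ℝ)..X t, φ u (z s)) - ∫ u in (0:ℝ)..X s, φ u (z s)|) := by fun_prop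
      simpa using this.tendsto s
    exact h1.sub (continuous_iff_continuousAt.2 fun h => (aux_int_hasDeriv hg2c h).continuousAt)
  let C := (E * (N * E) * 2 + M * L) + (2 * M * M * M * L ^ 3 + C1 * (2 + L))
    + (M * M * L ^ 3 + C2 * (2 + L)) + 1
  have hc1 : 0 ≤ E * (N * E) * 2 + M * L := by positivity
  have hc2 : 0 ≤ 2 * M * M * M * L ^ 3 + C1 * (2 + L) := by positivity
  have hc3 : 0 ≤ M * M * L ^ 3 + C2 * (2 + L) := by positivity
  refine ⟨y, F, C, by simp only [C]; positivity, hyc, hFc, ?_, fun s hs t ht => ?_⟩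
  · simp only [y]; rw [hX0, hφ0, hz0]
  set d := |t - s| ^ β with hd
  set h := |t - s| with hh
  have hh0 : 0 ≤ h := abs_nonneg _
  have hh2 : h ≤ 2 := abs_le.2 ⟨by linarith [hs.2, ht.1], by linarith [hs.1, ht.2]⟩
  have hd0 : 0 ≤ d := Real.rpow_nonneg hh0 _
  have hhd : h ≤ 2 * d := by
    rcases hh0.eq_or_lt with h0 | h0
    · rw [← h0]; positivity
    · have e : h = h ^ (1 - β) * h ^ β := by
        rw [← Real.rpow_add h0]; simp
      have h1 : h ^ (1 - β) ≤ 2 := by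
        calc h ^ (1 - β) ≤ 2 ^ (1 - β) := Real.rpow_le_rpow hh0 hh2 (by linarith)
          _ ≤ 2 ^ (1:ℝ) := Real.rpow_le_rpow_of_exponent_le (by norm_num) (by linarith)
          _ = 2 := by simp
      calc h = h ^ (1 - β) * h ^ β := e
        _ ≤ 2 * d := mul_le_mul_of_nonneg_right h1 hd0
  have hXd : |X t - X s| ≤ L * d := hXL s t
  have hXr : ∀ r ∈ Set.uIcc s t, |X t - X r| ≤ L * d := by
    intro r hr
    refine (hXL r t).trans (mul_le_mul_of_nonneg_left ?_ hL)
    refine Real.rpow_le_rpow (abs_nonneg _) ?_ hβ.le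
    rw [Set.uIcc_comm] at hr
    have := aux_abs_sub_le hr
    rwa [abs_sub_comm, abs_sub_comm s t] at this
  have hX3 : |X t - X s| ^ 3 ≤ L ^ 3 * d ^ 3 := by
    rw [← mul_pow]; exact pow_le_pow_left₀ (abs_nonneg _) hXd 3
  have hhh : h * (h + L * d) ≤ (2 + L) * (h * d) := by nlinarith [mul_nonneg hh0 hd0]
  have hd3 : 0 ≤ d ^ 3 := by positivity
  have hhd0 : 0 ≤ h * d := by positivity
  refine ⟨?_, ?_, ?_⟩
  · refine (hyd s t).trans ?_
    have k1 : E * |z t - z s| ≤ E * (N * E * (2 * d)) :=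
      mul_le_mul_of_nonneg_left ((hzl s t).trans
        (mul_le_mul_of_nonneg_left hhd (by positivity))) hE0.le
    have k2 := mul_le_mul_of_nonneg_left hXd hM0
    calc _ ≤ (E * (N * E) * 2 + M * L) * d := by linarith
      _ ≤ C * d := mul_le_mul_of_nonneg_right (by simp only [C]; linarith) hd0
  · have k1 := hI1 s t _ hXr
    simp only [hJz] at k1
    have k2 := hφT (X s) (X t) (z s)
    have e : y t - y s - (∫ r in s..t, b (y r)) - σ (y s) * (X t - X s)
          - 1 / 2 * (σ' (y s) * σ (y s)) * (X t - X s) ^ 2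
        = (φ (X t) (z t) - φ (X t) (z s) - ∫ r in s..t, b (y r))
          + (φ (X t) (z s) - φ (X s) (z s) - σ (φ (X s) (z s)) * (X t - X s)
        - 1 / 2 * (σ' (φ (X s) (z s)) * σ (φ (X s) (z s))) * (X t - X s) ^ 2) := by
      simp only [y]; ring
    rw [e]
    refine (abs_add_le _ _).trans ?_
    have k3 := mul_le_mul_of_nonneg_left hhh hC1
    have k4 := mul_le_mul_of_nonneg_left hX3 (a := 2 * M * M * M) (by positivity)
    have k5 : 0 ≤ (2 * M * M * M * L ^ 3) * (h * d) := by positivity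
    have k6 : 0 ≤ (C1 * (2 + L)) * d ^ 3 := by positivity
    calc _ ≤ (2 * M * M * M * L ^ 3 + C1 * (2 + L)) * (d ^ 3 + h * d) := by linarith
      _ ≤ C * (d ^ 3 + h * d) :=
          mul_le_mul_of_nonneg_right (by simp only [C]; linarith) (by positivity)
  · have k1 := hI2 s t _ hXr
    have k2 := hHh (X s) (X t) (z s) (hXR s) (hXR t)
    have e0 : (∫ r in (0:ℝ)..t, g2 r) - (∫ r in (0:ℝ)..s, g2 r) = ∫ r in s..t, g2 r :=
      intervalIntegral.integral_interval_sub_left (hg2c.intervalIntegrable _ _)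
        (hg2c.intervalIntegrable _ _)
    have e : F t - F s - y s * (X t - X s) - 1 / 2 * σ (y s) * (X t - X s) ^ 2
        = ((∫ u in (0:ℝ)..X t, φ u (z t)) - (∫ u in (0:ℝ)..X t, φ u (z s)) - ∫ r in s..t, g2 r)
          + ((∫ u in (0:ℝ)..X t, φ u (z s)) - (∫ u in (0:ℝ)..X s, φ u (z s))
            - φ (X s) (z s) * (X t - X s)
            - 1 / 2 * σ (φ (X s) (z s)) * (X t - X s) ^ 2) := by
      rw [← e0]; simp only [y, F]; ring
    rw [e]
    refine (abs_add_le _ _).trans ?_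
    have k3 := mul_le_mul_of_nonneg_left hhh hC2
    have k4 := mul_le_mul_of_nonneg_left hX3 (a := M * M) (by positivity)
    have k5 : 0 ≤ (M * M * L ^ 3) * (h * d) := by positivity
    have k6 : 0 ≤ (C2 * (2 + L)) * d ^ 3 := by positivity
    calc _ ≤ (M * M * L ^ 3 + C2 * (2 + L)) * (d ^ 3 + h * d) := by linarith
      _ ≤ C * (d ^ 3 + h * d) :=
          mul_le_mul_of_nonneg_right (by simp only [C]; linarith) (by positivity)

theorem aux_extend {α β : ℝ} (hβ : 0 < β) (hβα : β < α) {x : ℝ → ℝ} (hx : HolderOnIcc α 0 2 x) :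
    ∃ X : ℝ → ℝ, ∃ L R : ℝ, 0 ≤ L ∧ Continuous X ∧ X 0 = 0 ∧ (∀ t, |X t| ≤ R) ∧
      (∀ s t, |X t - X s| ≤ L * |t - s| ^ β) ∧
      ∀ t ∈ Set.Icc (0:ℝ) 2, X t = x t - x 0 := by
  obtain ⟨L, hL, hx⟩ := hx
  have h02 : (0:ℝ) ≤ 2 := by norm_num
  let p : ℝ → ℝ := fun t => (Set.projIcc (0:ℝ) 2 h02 t : ℝ)
  have hp : ∀ t, p t ∈ Set.Icc (0:ℝ) 2 := fun t => (Set.projIcc (0:ℝ) 2 h02 t).2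
  have hpe : ∀ t ∈ Set.Icc (0:ℝ) 2, p t = t := fun t ht => by
    simp only [p]; rw [Set.projIcc_of_mem h02 ht]
  have hpl : ∀ s t, |p t - p s| ≤ |t - s| := by
    intro s t
    have := (LipschitzWith.projIcc h02).dist_le_mul t s
    simpa [Subtype.dist_eq, Real.dist_eq] using this
  have hbd : ∀ s t, |p t - p s| ≤ 2 := fun s t =>
    abs_le.2 ⟨by linarith [(hp s).2, (hp t).1], by linarith [(hp s).1, (hp t).2]⟩
  have hα : 0 < α := hβ.trans hβα
  have hH : ∀ s t, |(x (p t) - x 0) - (x (p s) - x 0)| ≤ L * 2 ^ (α - β) * |t - s| ^ β := by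
    intro s t
    rw [sub_sub_sub_cancel_right]
    refine (hx _ (hp s) _ (hp t)).trans ?_
    rw [mul_assoc]
    refine mul_le_mul_of_nonneg_left ?_ hL.le
    have h1 : |p t - p s| ^ α = |p t - p s| ^ (α - β) * |p t - p s| ^ β := by
      rw [← Real.rpow_add_of_nonneg (abs_nonneg _) (by linarith) hβ.le]; simp
    rw [h1]
    exact mul_le_mul (Real.rpow_le_rpow (abs_nonneg _) (hbd s t) (by linarith))
      (Real.rpow_le_rpow (abs_nonneg _) (hpl s t) hβ.le) (by positivity) (by positivity)
  have hp0 : p 0 = 0 := hpe 0 ⟨le_rfl, h02⟩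
  refine ⟨fun t => x (p t) - x 0, L * 2 ^ (α - β), L * 2 ^ α, by positivity, ?_, ?_, fun t => ?_,
    hH, fun t ht => ?_⟩
  · rw [continuous_iff_continuousAt]
    intro s
    rw [ContinuousAt, tendsto_iff_norm_sub_tendsto_zero]
    refine squeeze_zero (fun _ => norm_nonneg _) (fun t => hH s t) ?_
    have : Continuous (fun t => L * 2 ^ (α - β) * |t - s| ^ β) := by
      refine continuous_const.mul (Continuous.rpow_const (by fun_prop) (fun _ => Or.inr hβ.le))
    have := this.tendsto s
    simpa [Real.zero_rpow hβ.ne'] using this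
  · simp [hp0]
  · have := hx 0 ⟨le_rfl, h02⟩ _ (hp t)
    refine this.trans (mul_le_mul_of_nonneg_left ?_ hL.le)
    refine Real.rpow_le_rpow (abs_nonneg _) ?_ hα.le
    have := hbd 0 t
    rwa [hp0] at this
  · simp only [hpe t ht]

theorem aux_avg {w : ℝ → ℝ} (hw : Continuous w) (t : ℝ) :
    Filter.Tendsto (fun ε => ε⁻¹ * ∫ u in (0:ℝ)..t, (w (u + ε) - w u)) (nhdsWithin 0 (Set.Ioi 0))
      (nhds (w t - w 0)) := by
  have h1 : ∀ a : ℝ, Filter.Tendsto (fun ε => ε⁻¹ * ∫ u in a..(a + ε), w u)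
      (nhdsWithin 0 (Set.Ioi 0)) (nhds (w a)) := by
    intro a
    have := (aux_int_hasDeriv hw a).tendsto_slope_zero_right
    refine this.congr (fun ε => ?_)
    rw [smul_eq_mul, intervalIntegral.integral_interval_sub_left (hw.intervalIntegrable _ _)
        (hw.intervalIntegrable _ _)]
  have h2 := (h1 t).sub (h1 0)
  refine h2.congr (fun ε => ?_)
  have hi : ∀ a b, IntervalIntegrable w MeasureTheory.volume a b :=
    fun a b => hw.intervalIntegrable _ _
  rw [intervalIntegral.integral_sub
    (Continuous.intervalIntegrable (by fun_prop) _ _) (hi _ _),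
    intervalIntegral.integral_comp_add_right, ← mul_sub]
  congr 1
  have e1 := intervalIntegral.integral_add_adjacent_intervals (hi 0 t) (hi t (t + ε))
  have e2 := intervalIntegral.integral_add_adjacent_intervals (hi 0 (0 + ε)) (hi (0 + ε) (t + ε))
  linarith

theorem stmt_6 (α β : ℝ) (hβ : 1/3 < β) (hβα : β < α) (hα : α < 1)
    (x : ℝ → ℝ) (hx : HolderOnIcc α 0 2 x)
    (σ : ℝ → ℝ) (hσ : ContDiff ℝ 2 σ)
    (hσbdd : ∃ M : ℝ, ∀ z : ℝ, |σ z| ≤ M ∧ |deriv σ z| ≤ M ∧ |deriv (deriv σ) z| ≤ M)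
    (b : ℝ → ℝ) (hblip : ∃ K : NNReal, LipschitzWith K b)
    (hbbdd : ∃ M : ℝ, ∀ z : ℝ, |b z| ≤ M)
    (y₀ : ℝ) :
    ∃ (y : ℝ → ℝ) (A : ℝ → ℝ → ℝ),
      HolderOnIcc β 0 2 y ∧ y 0 = y₀ ∧ IsLevyArea0 β x y A ∧
      ∀ t ∈ Set.Icc (0:ℝ) 1,
        Filter.Tendsto (fun ε => Ieps x y A σ 0 t ε) (nhdsWithin 0 (Set.Ioi 0))
          (nhds (y t - y₀ - ∫ s in (0:ℝ)..t, b (y s))) := by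
  obtain ⟨M, hM⟩ := hσbdd
  obtain ⟨K, hb⟩ := hblip
  obtain ⟨N, hbN⟩ := hbbdd
  have hβ0 : 0 < β := by linarith
  have hβ1 : β < 1 := by linarith
  obtain ⟨X, L, R, hL, hXc, hX0, hXR, hXL, hXx⟩ := aux_extend hβ0 hβα hx
  have hσd : ∀ r, HasDerivAt σ (deriv σ r) r := fun r =>
    ((hσ.differentiable (by norm_num)) r).hasDerivAt
  have hσ1 : ContDiff ℝ 1 (deriv σ) := by
    have : ContDiff ℝ (1 + 1) σ := by simpa [one_add_one_eq_two] using hσ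
    exact (contDiff_succ_iff_deriv.1 this).2.2
  have hσdd : ∀ r, HasDerivAt (deriv σ) (deriv (deriv σ) r) r := fun r =>
    ((hσ1.differentiable (by norm_num)) r).hasDerivAt
  have hlip : ∀ r s, |deriv σ r - deriv σ s| ≤ M * |r - s| :=
    fun r s => aux_mvt hσdd (fun r _ => (hM r).2.2)
  have hM0 : 0 ≤ M := (abs_nonneg _).trans (hM 0).1
  have hσc := hσ.continuous
  have hσ'c := hσ1.continuous
  obtain ⟨y, F, C, hC, hyc, hFc, hy0, hest⟩ := aux_core (β := β) hβ0 hβ1 hXc hX0 hXR hL hXL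
    hσd hσ1.continuous (fun r => (hM r).1) (fun r => (hM r).2.1) hlip hb hbN y₀
  let A : ℝ → ℝ → ℝ := fun s t => F t - F s - 1 / 2 * (y t + y s) * (x t - x s)
  let B : ℝ → ℝ → ℝ := fun s t => F t - F s - 1 / 2 * (y t + y s) * (X t - X s)
  have hδ : ∀ s ∈ Set.Icc (0:ℝ) 2, ∀ t ∈ Set.Icc (0:ℝ) 2, X t - X s = x t - x s := by
    intro s hs t ht
    rw [hXx s hs, hXx t ht]; ring
  refine ⟨y, A, ⟨C, hC, fun s hs t ht => (hest s hs t ht).1⟩, hy0, ⟨fun r _ s _ t _ => ?_, ?_⟩, ?_⟩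
  · simp only [A]; ring
  · refine ⟨C * 6 + M * L ^ 2 + C * L, by positivity, fun s hs t ht => ?_⟩
    obtain ⟨h1, -, h3⟩ := hest s hs t ht
    have hXd := hXL s t
    have e : A s t = (F t - F s - y s * (X t - X s) - 1 / 2 * σ (y s) * (X t - X s) ^ 2)
        + (1 / 2 * σ (y s) * (X t - X s) ^ 2 - 1 / 2 * (y t - y s) * (X t - X s)) := by
      simp only [A]; rw [← hδ s hs t ht]; ring
    have hd2 : |t - s| ^ (2 * β) = (|t - s| ^ β) ^ 2 := by
      rw [mul_comm, Real.rpow_mul (abs_nonneg _)]; norm_num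
    rw [e, hd2]
    have hh0 : 0 ≤ |t - s| := abs_nonneg _
    have hh2 : |t - s| ≤ 2 := abs_le.2 ⟨by linarith [hs.2, ht.1], by linarith [hs.1, ht.2]⟩
    set d := |t - s| ^ β with hd
    set h := |t - s| with hh
    have hd0 : 0 ≤ d := Real.rpow_nonneg hh0 _
    have hd2 : d ≤ 2 := by
      calc h ^ β ≤ 2 ^ β := Real.rpow_le_rpow hh0 hh2 hβ0.le
          _ ≤ 2 ^ (1:ℝ) := Real.rpow_le_rpow_of_exponent_le (by norm_num) (by linarith)
          _ = 2 := by simp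
    have hhd : h ≤ 2 * d := by
      have e : h = h ^ (1 - β) * h ^ β := by
        rw [← Real.rpow_add_of_nonneg hh0 (by linarith) hβ0.le]; simp
      have h1 : h ^ (1 - β) ≤ 2 := by
        calc h ^ (1 - β) ≤ 2 ^ (1 - β) := Real.rpow_le_rpow hh0 hh2 (by linarith)
          _ ≤ 2 ^ (1:ℝ) := Real.rpow_le_rpow_of_exponent_le (by norm_num) (by linarith)
          _ = 2 := by simp
      calc h = h ^ (1 - β) * h ^ β := e
        _ ≤ 2 * d := mul_le_mul_of_nonneg_right h1 hd0
    have k1 : d ^ 3 + h * d ≤ 4 * d ^ 2 := by nlinarith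
    have k2 : |1 / 2 * σ (y s) * (X t - X s) ^ 2| ≤ M * (L * d) ^ 2 := by
      rw [abs_mul, abs_mul, abs_pow]
      have := (hM (y s)).1
      refine mul_le_mul ?_ (pow_le_pow_left₀ (abs_nonneg _) hXd 2) (by positivity) hM0
      rw [abs_of_pos (by norm_num)]
      linarith [abs_nonneg (σ (y s))]
    have k3 : |1 / 2 * (y t - y s) * (X t - X s)| ≤ (C * d) * (L * d) := by
      rw [abs_mul, abs_mul]
      refine mul_le_mul ?_ hXd (abs_nonneg _) (by positivity)
      rw [abs_of_pos (by norm_num)]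
      linarith [abs_nonneg (y t - y s)]
    have k4 := mul_le_mul_of_nonneg_left k1 hC.le
    have k5 : 0 ≤ C * d ^ 2 := by positivity
    refine (abs_add_le _ _).trans ?_
    have k6 := abs_sub (1 / 2 * σ (y s) * (X t - X s) ^ 2) (1 / 2 * (y t - y s) * (X t - X s))
    nlinarith
  intro t ht
  have hbyc : Continuous (fun r => b (y r)) := hb.continuous.comp hyc
  let w : ℝ → ℝ := fun t => y t - ∫ r in (0:ℝ)..t, b (y r)
  have hwc : Continuous w := hyc.sub
    (continuous_iff_continuousAt.2 fun h => (aux_int_hasDeriv hbyc h).continuousAt)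
  have hlim := aux_avg hwc t
  have hw0 : w t - w 0 = y t - y₀ - ∫ s in (0:ℝ)..t, b (y s) := by
    simp only [w]; rw [hy0]; simp; ring
  rw [hw0] at hlim
  let C' := C + M * C ^ 2 * L + M * C
  have hC' : 0 ≤ C' := by simp only [C']; positivity
  have herr : ∀ ε ∈ Set.Ioo (0:ℝ) 1,
      |Ieps x y A σ 0 t ε - ε⁻¹ * ∫ u in (0:ℝ)..t, (w (u + ε) - w u)|
        ≤ C' * (ε ^ (3 * β - 1) + ε ^ β) := by
    intro ε hε
    have hI : Ieps x y A σ 0 t ε = ε⁻¹ * ∫ u in (0:ℝ)..t,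
        (((σ (y u) + σ (y (u + ε))) / 2) * (X (u + ε) - X u)
          + deriv σ (y u) * B u (u + ε)) := by
      unfold Ieps
      rw [intervalIntegral.integral_add (Continuous.intervalIntegrable (by fun_prop) _ _)
        (Continuous.intervalIntegrable (by fun_prop) _ _), mul_add]
      have hcg : ∀ u ∈ Set.uIcc 0 t, X (u + ε) - X u = x (u + ε) - x u := by
        intro u hu
        rw [Set.uIcc_of_le ht.1] at hu
        exact hδ u ⟨hu.1, by linarith [hu.2, ht.2]⟩ (u + ε)
          ⟨by linarith [hu.1, hε.1], by linarith [hu.2, ht.2, hε.2]⟩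
      congr 2
      · refine intervalIntegral.integral_congr (fun u hu => ?_)
        rw [hcg u hu]
      · refine intervalIntegral.integral_congr (fun u hu => ?_)
        simp only [A, B]
        rw [hcg u hu]
    rw [hI, ← mul_sub, ← intervalIntegral.integral_sub
      (Continuous.intervalIntegrable (by fun_prop) _ _)
      (Continuous.intervalIntegrable (by fun_prop) _ _)]
    have hbound : ∀ u ∈ Set.uIoc 0 t,
        ‖((σ (y u) + σ (y (u + ε))) / 2) * (X (u + ε) - X u)
          + deriv σ (y u) * B u (u + ε) - (w (u + ε) - w u)‖
          ≤ C' * ((ε ^ β) ^ 3 + ε * ε ^ β) := by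
      intro u hu
      rw [Set.uIoc_of_le ht.1] at hu
      obtain ⟨h1, h2, h3⟩ := hest u ⟨hu.1.le, by linarith [hu.2, ht.2]⟩ (u + ε)
          ⟨by linarith [hu.1, hε.1], by linarith [hu.2, ht.2, hε.2]⟩
      have hXd := hXL u (u + ε)
      rw [add_sub_cancel_left, abs_of_pos hε.1] at h1 h2 h3 hXd
      have h4 := aux_taylor1 hσd hlip (y u) (y (u + ε)) hM0
      have hw : w (u + ε) - w u = y (u + ε) - y u - ∫ r in u..(u + ε), b (y r) := by
        have := intervalIntegral.integral_interval_sub_left (hbyc.intervalIntegrable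
          (μ := MeasureTheory.volume) 0 (u + ε)) (hbyc.intervalIntegrable 0 u)
        simp only [w]; linarith
      rw [← hw] at h2
      have e : ((σ (y u) + σ (y (u + ε))) / 2) * (X (u + ε) - X u)
          + deriv σ (y u) * B u (u + ε) - (w (u + ε) - w u)
          = -(w (u + ε) - w u - σ (y u) * (X (u + ε) - X u)
              - 1 / 2 * (deriv σ (y u) * σ (y u)) * (X (u + ε) - X u) ^ 2)
            + 1 / 2 * ((σ (y (u + ε)) - σ (y u) - deriv σ (y u) * (y (u + ε) - y u))
                * (X (u + ε) - X u))
            + deriv σ (y u) * (F (u + ε) - F u - y u * (X (u + ε) - X u)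
                - 1 / 2 * σ (y u) * (X (u + ε) - X u) ^ 2) := by
        simp only [B]; ring
      rw [e, Real.norm_eq_abs]
      set d := ε ^ β with hd
      have hd0 : 0 ≤ d := Real.rpow_nonneg hε.1.le _
      have hed : 0 ≤ ε * d := mul_nonneg hε.1.le hd0
      have k1 := mul_le_mul h4 hXd (abs_nonneg _) (by positivity)
      have k2 : M * |y (u + ε) - y u| ^ 2 * (L * d) ≤ M * (C * d) ^ 2 * (L * d) :=
        mul_le_mul_of_nonneg_right (mul_le_mul_of_nonneg_left
          (pow_le_pow_left₀ (abs_nonneg _) h1 2) hM0) (by positivity)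
      have k3 := mul_le_mul (hM (y u)).2.1 h3 (abs_nonneg _) hM0
      refine (abs_add_le _ _).trans ((add_le_add (abs_add_le _ _) le_rfl).trans ?_)
      rw [abs_neg, abs_mul (1 / 2), abs_of_pos (by norm_num : (0:ℝ) < 1 / 2), abs_mul, abs_mul]
      have k4 : 0 ≤ |σ (y (u + ε)) - σ (y u) - deriv σ (y u) * (y (u + ε) - y u)|
        * |X (u + ε) - X u| := by positivity
      have k5 : 0 ≤ M * C ^ 2 * L * (ε * d) := by positivity
      simp only [C']
      have k6 : M * (C * d) ^ 2 * (L * d) = M * C ^ 2 * L * d ^ 3 := by ring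
      linarith
    have hint := intervalIntegral.norm_integral_le_of_norm_le_const hbound
    rw [Real.norm_eq_abs, sub_zero, abs_of_nonneg ht.1] at hint
    rw [abs_mul, abs_of_pos (inv_pos.2 hε.1)]
    have hε0 := hε.1
    have e1 : (ε ^ β) ^ 3 = ε * ε ^ (3 * β - 1) := by
      rw [← Real.rpow_natCast, ← Real.rpow_mul hε0.le]
      nth_rewrite 2 [← Real.rpow_one ε]
      rw [← Real.rpow_add hε0]
      congr 1; push_cast; ring
    rw [e1] at hint
    have k : 0 ≤ C' * (ε * ε ^ (3 * β - 1) + ε * ε ^ β) := by positivity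
    calc _ ≤ ε⁻¹ * (C' * (ε * ε ^ (3 * β - 1) + ε * ε ^ β)) := by
            refine mul_le_mul_of_nonneg_left (hint.trans ?_) (inv_pos.2 hε0).le
            exact mul_le_of_le_one_right k ht.2
      _ = _ := by field_simp
  have hzero : Filter.Tendsto (fun ε : ℝ => C' * (ε ^ (3 * β - 1) + ε ^ β))
      (nhdsWithin 0 (Set.Ioi 0)) (nhds 0) := by
    have hc : Continuous (fun ε : ℝ => C' * (ε ^ (3 * β - 1) + ε ^ β)) := by
      refine continuous_const.mul (Continuous.add ?_ ?_)
      · exact Continuous.rpow_const continuous_id (fun _ => Or.inr (by linarith))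
      · exact Continuous.rpow_const continuous_id (fun _ => Or.inr (by linarith))
    have := hc.tendsto 0
    rw [Real.zero_rpow hβ0.ne', Real.zero_rpow (by linarith : 3 * β - 1 ≠ 0)] at this
    simp only [add_zero, mul_zero] at this
    exact this.mono_left nhdsWithin_le_nhds
  have hdiff : Filter.Tendsto (fun ε => Ieps x y A σ 0 t ε
      - ε⁻¹ * ∫ u in (0:ℝ)..t, (w (u + ε) - w u)) (nhdsWithin 0 (Set.Ioi 0)) (nhds 0) := by
    refine squeeze_zero_norm' ?_ hzero
    filter_upwards [Ioo_mem_nhdsGT (zero_lt_one (α := ℝ))] with ε hε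
    exact herr ε hε
  have := hdiff.add hlim
  simpa using this
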